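/- arXiv:1403.5700 — 3 statements merged into one kernel-verified Lean document; each statement's English description precedes it below -/
import Mathlib

section
/- (Theorem 1, no-trap form.) Let M ∈ SU(1,1) be a local maximum of the transmission coefficient T on SU(1,1), i.e. there exists ε > 0 such that T(M') ≤ T(M) for every M' ∈ SU(1,1) with ‖M' − M‖ < ε (any norm on 2×2 complex matrices). Then T(M) = 1, i.e. M is a global maximum of T, and M is diagonal with M₁₁ = e^{iφ}, M₂₂ = e^{−iφ} for some real φ. -/
open Matrix Complex

/-- The matrix η = diag(1, -1). -/
noncomputable def etaMat : Matrix (Fin 2) (Fin 2) ℂ := Matrix.diagonal ![1, -1]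

/-- `M ∈ SU(1,1)`: `det M = 1` and `Mᴴ η M = η`. -/
def SU11 (M : Matrix (Fin 2) (Fin 2) ℂ) : Prop :=
  M.det = 1 ∧ Mᴴ * etaMat * M = etaMat

/-- The transmission coefficient `T(M) = 1/|M₂₂|²`. -/
noncomputable def T (M : Matrix (Fin 2) (Fin 2) ℂ) : ℝ :=
  1 / ‖M 1 1‖ ^ 2

/- Use the elementwise sup norm on 2×2 matrices; on a finite-dimensional space
all norms are equivalent, so the choice of norm is immaterial. -/
attribute [local instance] Matrix.normedAddCommGroup

lemma su11_iff (M : Matrix (Fin 2) (Fin 2) ℂ) : SU11 M ↔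
    M 1 1 = star (M 0 0) ∧ M 1 0 = star (M 0 1) ∧ ‖M 1 1‖ ^ 2 = 1 + ‖M 0 1‖ ^ 2 := by
  have key : ∀ z : ℂ, z * star z = ((‖z‖ ^ 2 : ℝ) : ℂ) := by
    intro z
    have := Complex.mul_conj' z
    push_cast
    exact this
  constructor
  · rintro ⟨hd, h⟩
    have h00 := congrFun (congrFun h 0) 0
    have h01 := congrFun (congrFun h 0) 1
    have h10 := congrFun (congrFun h 1) 0
    have h11 := congrFun (congrFun h 1) 1
    simp [Matrix.mul_apply, Fin.sum_univ_two, etaMat, Matrix.det_fin_two] at h00 h01 h10 h11 hd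
    have e1 : M 1 1 = star (M 0 0) := by
      simp only [Complex.star_def]
      linear_combination (starRingEnd ℂ (M 0 0)) * hd + (-M 1 1) * h00 + (M 1 0) * h01
    have e2 : M 1 0 = star (M 0 1) := by
      simp only [Complex.star_def]
      linear_combination (starRingEnd ℂ (M 0 1)) * hd - (M 1 1) * h10 + (M 1 0) * h11
    refine ⟨e1, e2, ?_⟩
    have k1 := key (M 1 1)
    have k2 := key (M 0 1)
    simp only [Complex.star_def] at k1 k2
    have : ((‖M 1 1‖ ^ 2 : ℝ) : ℂ) = ((1 + ‖M 0 1‖ ^ 2 : ℝ) : ℂ) := by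
      rw [Complex.ofReal_add, ← k1, ← k2]
      push_cast
      linear_combination -h11
    exact_mod_cast this
  · rintro ⟨e1, e2, h⟩
    have k1 := key (M 0 0)
    have k2 := key (M 0 1)
    have hn : ‖M 1 1‖ = ‖M 0 0‖ := by rw [e1, norm_star]
    have hh : (M 0 0) * star (M 0 0) = 1 + M 0 1 * star (M 0 1) := by
      rw [k1, k2, ← hn, h]; push_cast; ring
    simp only [Complex.star_def] at e1 e2 hh
    refine ⟨?_, ?_⟩
    · rw [Matrix.det_fin_two, e1, e2, hh]; ring
    · ext i j
      fin_cases i <;> fin_cases j <;>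
        simp [Matrix.mul_apply, Fin.sum_univ_two, etaMat, e1, e2]
      · linear_combination hh
      · ring
      · ring
      · linear_combination -hh

theorem stmt2 (M : Matrix (Fin 2) (Fin 2) ℂ) (hM : SU11 M)
    (hmax : ∃ ε > (0 : ℝ), ∀ M' : Matrix (Fin 2) (Fin 2) ℂ,
      SU11 M' → ‖M' - M‖ < ε → T M' ≤ T M) :
    T M = 1 ∧ (∀ M' : Matrix (Fin 2) (Fin 2) ℂ, SU11 M' → T M' ≤ T M) ∧
    M 0 1 = 0 ∧ M 1 0 = 0 ∧
    ∃ φ : ℝ, M 0 0 = Complex.exp (φ * Complex.I) ∧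
      M 1 1 = Complex.exp (-(φ : ℂ) * Complex.I) := by
  have key := (su11_iff M).1 hM
  obtain ⟨e1, e2, h⟩ := key
  obtain ⟨ε, hε, hm⟩ := hmax
  have hb : M 0 1 = 0 := by
    by_contra hb
    have hbpos : 0 < ‖M 0 1‖ := norm_pos_iff.2 hb
    let s : ℝ → ℝ := fun t => Real.sqrt ((1 + (1 - t) ^ 2 * ‖M 0 1‖ ^ 2) / (1 + ‖M 0 1‖ ^ 2))
    have hs0 : s 0 = 1 := by
      have : (1 + ‖M 0 1‖ ^ 2) ≠ 0 := by positivity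
      simp [s, div_self this]
    have hsc : Continuous s := by
      simp only [s]
      fun_prop
    let F : ℝ → Matrix (Fin 2) (Fin 2) ℂ := fun t =>
      !![(s t : ℂ) * M 0 0, ((1 - t : ℝ) : ℂ) * M 0 1;
        ((1 - t : ℝ) : ℂ) * M 1 0, (s t : ℂ) * M 1 1]
    have hev : ∀ᶠ t in nhds (0 : ℝ), ∀ i j, ‖(F t - M) i j‖ < ε := by
      rw [Filter.eventually_all]
      intro i
      rw [Filter.eventually_all]
      intro j
      have hc : Continuous fun t => ‖(F t - M) i j‖ := by
        fin_cases i <;> fin_cases j <;> simp [F] <;> fun_prop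
      have h0 : ‖(F 0 - M) i j‖ < ε := by
        fin_cases i <;> fin_cases j <;> simp [F, hs0, hε]
      exact hc.continuousAt.eventually_lt continuousAt_const h0
    have hev2 : ∀ᶠ t in nhdsWithin (0 : ℝ) (Set.Ioi 0), ∀ i j, ‖(F t - M) i j‖ < ε :=
      hev.filter_mono nhdsWithin_le_nhds
    have hev3 : ∀ᶠ t in nhdsWithin (0 : ℝ) (Set.Ioi 0), t ∈ Set.Ioo (0 : ℝ) 1 :=
      Ioo_mem_nhdsGT one_pos
    obtain ⟨t, ht, ht0, ht1⟩ := (hev2.and hev3).exists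
    have hs2 : s t ^ 2 = (1 + (1 - t) ^ 2 * ‖M 0 1‖ ^ 2) / (1 + ‖M 0 1‖ ^ 2) :=
      Real.sq_sqrt (by positivity)
    have hnorm : ‖F t 1 1‖ ^ 2 = 1 + (1 - t) ^ 2 * ‖M 0 1‖ ^ 2 := by
      have : F t 1 1 = (s t : ℂ) * M 1 1 := by simp [F]
      rw [this, norm_mul, mul_pow, h, Complex.norm_real, Real.norm_eq_abs, sq_abs, hs2]
      field_simp
    have hSU : SU11 (F t) := by
      rw [su11_iff]
      refine ⟨?_, ?_, ?_⟩
      · simp [F, e1]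
      · simp [F, e2]
      · rw [hnorm]
        have : F t 0 1 = ((1 - t : ℝ) : ℂ) * M 0 1 := by simp [F]
        rw [this, norm_mul, mul_pow, Complex.norm_real, Real.norm_eq_abs, sq_abs]
    have hT := hm (F t) hSU ((Matrix.norm_lt_iff hε).2 ht)
    unfold T at hT
    rw [hnorm, h, one_div_le_one_div (by positivity) (by positivity)] at hT
    have hb2 : 0 < ‖M 0 1‖ ^ 2 := by positivity
    nlinarith [mul_pos hb2 (mul_pos ht0 (by linarith : (0:ℝ) < 2 - t))]
  have hd : ‖M 1 1‖ ^ 2 = 1 := by rw [h, hb]; simp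
  have hT1 : T M = 1 := by unfold T; rw [hd]; norm_num
  have ha : ‖M 0 0‖ = 1 := by
    rw [e1, norm_star] at hd
    nlinarith [norm_nonneg (M 0 0)]
  have hexp : M 0 0 = Complex.exp ((M 0 0).arg * Complex.I) := by
    have := Complex.norm_mul_exp_arg_mul_I (M 0 0)
    rw [ha] at this
    simpa using this.symm
  refine ⟨hT1, ?_, hb, by rw [e2, hb]; simp, (M 0 0).arg, hexp, ?_⟩
  · intro M' h'
    have h3 := ((su11_iff M').1 h').2.2
    rw [hT1]
    unfold T
    rw [h3, div_le_one (by positivity)]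
    nlinarith [sq_nonneg ‖M' 0 1‖]
  · rw [e1]
    conv_lhs => rw [hexp]
    rw [Complex.star_def, ← Complex.exp_conj]
    simp
end

section
/- For every M ∈ SU(1,1) with T(M) < 1 and every ε > 0 there exists M' ∈ SU(1,1) with ‖M' − M‖ < ε (any norm on 2×2 complex matrices) and T(M') > T(M). Together with the absence of local minima, this shows the kinematic landscape T on SU(1,1) is trap free: its only extrema are global maxima with value 1. -/
open Matrix Complex

/- Use the elementwise sup norm on 2×2 matrices; on a finite-dimensional space
all norms are equivalent, so the choice of norm is immaterial. -/
attribute [local instance] Matrix.normedAddCommGroup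

lemma SU11_iff_aux (a b c d : ℂ) : SU11 !![a, b; c, d] ↔
    (a * d - b * c = 1 ∧ star a * a - star c * c = 1 ∧ star a * b - star c * d = 0 ∧
      star b * a - star d * c = 0 ∧ star b * b - star d * d = -1) := by
  unfold SU11 etaMat
  rw [Matrix.det_fin_two_of, ← Matrix.ext_iff]
  simp [Fin.forall_fin_two, Matrix.mul_apply, Fin.sum_univ_two, Matrix.diagonal_apply,
    sub_eq_add_neg, and_assoc]

lemma SU11_form (a b c d : ℂ) (h : SU11 !![a, b; c, d]) :
    a = star d ∧ c = star b ∧ star d * d = 1 + star b * b := by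
  rw [SU11_iff_aux] at h
  obtain ⟨h1, h2, h3, h4, h5⟩ := h
  have h6 : star a = d := by
    linear_combination (-star a) * h1 + d * h2 - c * h3
  have hd : star d * d = 1 + star b * b := by linear_combination -h5
  have hd0 : d ≠ 0 := by
    intro h0
    have := congrArg Complex.re hd
    simp [h0] at this
    nlinarith [mul_self_nonneg b.re, mul_self_nonneg b.im]
  have h7 : b = star c := by
    apply mul_left_cancel₀ hd0
    rw [h6] at h3
    linear_combination h3
  exact ⟨by rw [← h6, star_star], by rw [h7, star_star], hd⟩

lemma SU11_mk (b d : ℂ) (r s : ℝ) (hd : star d * d = 1 + star b * b)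
    (h : r ^ 2 * (1 + ‖b‖ ^ 2) = 1 + s ^ 2 * ‖b‖ ^ 2) :
    SU11 !![r * star d, s * b; s * star b, r * d] := by
  have hb : star b * b = ((‖b‖ ^ 2 : ℝ) : ℂ) := by
    push_cast; exact Complex.conj_mul' b
  have h' : (r : ℂ) ^ 2 * (1 + star b * b) = 1 + s ^ 2 * (star b * b) := by
    rw [hb]; exact_mod_cast h
  have er : star (r : ℂ) = r := Complex.conj_ofReal r
  have es : star (s : ℂ) = s := Complex.conj_ofReal s
  rw [SU11_iff_aux]
  simp only [star_mul', star_star, er, es]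
  refine ⟨?_, ?_, ?_, ?_, ?_⟩
  · linear_combination (r : ℂ) ^ 2 * hd + h'
  · linear_combination (r : ℂ) ^ 2 * hd + h'
  · ring
  · ring
  · linear_combination -(r : ℂ) ^ 2 * hd - h'

theorem stmt10 (M : Matrix (Fin 2) (Fin 2) ℂ) (hM : SU11 M) (hT : T M < 1) :
    ∀ ε > (0 : ℝ), ∃ M' : Matrix (Fin 2) (Fin 2) ℂ,
      SU11 M' ∧ ‖M' - M‖ < ε ∧ T M < T M' := by
  intro ε hε
  obtain ⟨a, b, c, d, rfl⟩ : ∃ a b c d, M = !![a, b; c, d] :=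
    ⟨_, _, _, _, Matrix.eta_fin_two M⟩
  obtain ⟨rfl, rfl, hd⟩ := SU11_form _ _ _ _ hM
  have hdn : ‖d‖ ^ 2 = 1 + ‖b‖ ^ 2 := by
    have e1 : star d * d = (‖d‖ : ℂ) ^ 2 := Complex.conj_mul' d
    have e2 : star b * b = (‖b‖ : ℂ) ^ 2 := Complex.conj_mul' b
    rw [e1, e2] at hd
    exact_mod_cast hd
  have hb : 0 < ‖b‖ ^ 2 := by
    rcases (sq_nonneg ‖b‖).lt_or_eq with h | h
    · exact h
    · exfalso
      simp [T, hdn, ← h] at hT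
  have hpos : 0 < 1 + ‖b‖ ^ 2 := by positivity
  let r : ℝ → ℝ := fun s => Real.sqrt ((1 + s ^ 2 * ‖b‖ ^ 2) / (1 + ‖b‖ ^ 2))
  have hr : ∀ s, r s ^ 2 = (1 + s ^ 2 * ‖b‖ ^ 2) / (1 + ‖b‖ ^ 2) := fun s =>
    Real.sq_sqrt (by positivity)
  have hr1 : r 1 = 1 := by simp [r, div_self hpos.ne']
  have hrc : Continuous r := by fun_prop
  let f : ℝ → Matrix (Fin 2) (Fin 2) ℂ := fun s =>
    !![(r s : ℂ) * star d, (s : ℂ) * b; (s : ℂ) * star b, (r s : ℂ) * d]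
  have hf : Continuous f := by
    refine continuous_matrix fun i j => ?_
    fin_cases i <;> fin_cases j <;> simp [f] <;> fun_prop
  have hf1 : f 1 = !![star d, b; star b, d] := by simp [f, hr1]
  have hg : Continuous fun s => ‖f s - f 1‖ := (hf.sub continuous_const).norm
  have hev : ∀ᶠ s in nhds (1 : ℝ), ‖f s - f 1‖ < ε := by
    apply hg.continuousAt.eventually_lt continuousAt_const
    simpa using hε
  have hev2 : ∀ᶠ s in nhds (1 : ℝ), 0 < s := lt_mem_nhds one_pos
  obtain ⟨s, ⟨h1, h2⟩, h3⟩ := (((hev.and hev2).filter_mono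
    (nhdsWithin_le_nhds (s := Set.Iio 1))).and self_mem_nhdsWithin).exists
  have h3 : s < 1 := h3
  refine ⟨f s, SU11_mk b d (r s) s hd ?_, by rwa [hf1] at h1, ?_⟩
  · rw [hr]; field_simp
  · have e : ‖f s 1 1‖ ^ 2 = 1 + s ^ 2 * ‖b‖ ^ 2 := by
      simp only [f, Matrix.of_apply, Matrix.cons_val_one, Matrix.cons_val_fin_one, norm_mul,
        mul_pow, Complex.norm_real, Real.norm_eq_abs, sq_abs, hr, hdn]
      field_simp
    unfold T
    rw [e]
    simp only [Matrix.of_apply, Matrix.cons_val_one, Matrix.cons_val_fin_one, hdn]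
    apply one_div_lt_one_div_of_lt (by positivity)
    have hs : s ^ 2 < 1 := by nlinarith
    have := mul_lt_mul_of_pos_right hs hb
    linarith
end

section
/- Let V : ℝ → ℝ be continuous with support contained in [−a, a] for some a > 0, let E = k² with k > 0, and for any A', A ∈ ℂ let ψ be a twice differentiable solution of −ψ'' + Vψ = Eψ on ℝ such that ψ(x) = A'·e^{ikx} + A·e^{−ikx} for all x < −a. Then there exist unique B, B' ∈ ℂ with ψ(x) = B·e^{ikx} + B'·e^{−ikx} for all x > a, and there exists a matrix M ∈ SU(1,1), depending only on V and E and not on the particular solution, such that (B, B')ᵀ = M·(A', A)ᵀ for every such solution. -/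
open Matrix Complex

theorem aux_prufer (q : ℝ → ℝ) (hq : Continuous q) (a : ℝ) (ha : 0 < a) (θ₀ : ℝ) :
    ∃ u v : ℝ → ℝ, u (-a) = Real.cos θ₀ ∧ v (-a) = Real.sin θ₀ ∧
      ∀ t ∈ Set.Ioo (-(a+1)) (a+1), HasDerivAt u (v t) t ∧ HasDerivAt v (q t * u t) t := by
  obtain ⟨Q, hQ⟩ := (isCompact_Icc (a := -(a+1)) (b := a+1)).exists_bound_of_continuousOn
    hq.continuousOn
  have hQ0 : 0 ≤ Q := (norm_nonneg _).trans (hQ 0 ⟨by linarith, by linarith⟩)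
  let f : ℝ → ℝ → ℝ := fun t x => q t * Real.cos x ^ 2 - Real.sin x ^ 2
  have hmem : -a ∈ Set.Icc (-(a+1)) (a+1) := ⟨by linarith, by linarith⟩
  let L : NNReal := ⟨Q + 1, by linarith⟩
  let K : NNReal := ⟨2 * (Q + 1), by linarith⟩
  let R : NNReal := ⟨(Q + 1) * (2 * a + 1), by positivity⟩
  have hPL : IsPicardLindelof f (tmin := -(a+1)) (tmax := a+1) ⟨-a, hmem⟩ θ₀ R 0 L K := by
    refine ⟨fun t ht => ?_, fun x _ => ?_, fun t ht x _ => ?_, ?_⟩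
    · have hd : ∀ x, HasDerivAt (f t) (-2 * (q t + 1) * (Real.sin x * Real.cos x)) x := by
        intro x
        have h1 := (((Real.hasDerivAt_cos x).pow 2).const_mul (q t)).sub
          ((Real.hasDerivAt_sin x).pow 2)
        refine h1.congr_deriv ?_
        push_cast
        ring
      refine (lipschitzWith_of_nnnorm_deriv_le (fun x => (hd x).differentiableAt) fun x => ?_).lipschitzOnWith
      rw [(hd x).deriv, ← NNReal.coe_le_coe, coe_nnnorm]
      change ‖-2 * (q t + 1) * (Real.sin x * Real.cos x)‖ ≤ 2 * (Q + 1)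
      have h1 : ‖q t + 1‖ ≤ Q + 1 := (norm_add_le _ _).trans (by simpa using hQ t ht)
      have h2 : ‖Real.sin x * Real.cos x‖ ≤ 1 := by
        rw [norm_mul]
        exact mul_le_one₀ (Real.abs_sin_le_one x) (norm_nonneg _) (Real.abs_cos_le_one x)
      rw [norm_mul, norm_mul]
      have h3 : ‖(-2 : ℝ)‖ = 2 := by norm_num
      rw [h3]
      nlinarith [norm_nonneg (q t + 1), norm_nonneg (Real.sin x * Real.cos x)]
    · fun_prop
    · change ‖q t * Real.cos x ^ 2 - Real.sin x ^ 2‖ ≤ Q + 1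
      have h1 := hQ t ht
      rw [Real.norm_eq_abs, abs_le] at h1 ⊢
      have := Real.sin_sq_add_cos_sq x
      constructor <;> nlinarith [sq_nonneg (Real.sin x), sq_nonneg (Real.cos x)]
    · change (Q + 1) * max (a + 1 - -a) (-a - -(a+1)) ≤ (Q + 1) * (2 * a + 1) - 0
      rw [max_eq_left (by linarith)]
      apply le_of_eq; ring
  obtain ⟨α, hα0, hα⟩ := hPL.exists_eq_forall_mem_Icc_hasDerivWithinAt₀
  have hle : -(a+1) ≤ a+1 := by linarith
  let β : ℝ → ℝ := fun t => α (Set.projIcc _ _ hle t)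
  have hβc : Continuous β := by
    have h1 : ContinuousOn α (Set.Icc (-(a+1)) (a+1)) := fun t ht => (hα t ht).continuousWithinAt
    exact (continuousOn_iff_continuous_domRestrict.1 h1).comp continuous_projIcc
  have hβα : ∀ t ∈ Set.Icc (-(a+1)) (a+1), β t = α t := by
    intro t ht
    simp only [β, Set.projIcc_of_mem hle ht]
  have hβ : ∀ t ∈ Set.Ioo (-(a+1)) (a+1), HasDerivAt β (f t (β t)) t := by
    intro t ht
    have hn : Set.Icc (-(a+1)) (a+1) ∈ nhds t := Icc_mem_nhds ht.1 ht.2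
    rw [hβα t (Set.Ioo_subset_Icc_self ht)]
    refine ((hα t (Set.Ioo_subset_Icc_self ht)).hasDerivAt hn).congr_of_eventuallyEq ?_
    filter_upwards [hn] with s hs using hβα s hs
  let g : ℝ → ℝ := fun t => (1 + q t) * (Real.sin (β t) * Real.cos (β t))
  have hg : Continuous g := by fun_prop
  let ρ : ℝ → ℝ := fun t => ∫ s in (-a)..t, g s
  have hρ : ∀ t, HasDerivAt ρ (g t) t := fun t => (hg.integral_hasStrictDerivAt (-a) t).hasDerivAt
  have hb0 : β (-a) = θ₀ := by rw [hβα _ hmem]; exact hα0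
  refine ⟨fun t => Real.exp (ρ t) * Real.cos (β t), fun t => Real.exp (ρ t) * Real.sin (β t),
    ?_, ?_, fun t ht => ⟨?_, ?_⟩⟩
  · simp [ρ, hb0]
  · simp [ρ, hb0]
  · refine ((hρ t).exp.mul (hβ t ht).cos).congr_deriv ?_
    simp only [g, f]
    linear_combination (Real.exp (ρ t) * Real.sin (β t)) * Real.sin_sq_add_cos_sq (β t)
  · refine ((hρ t).exp.mul (hβ t ht).sin).congr_deriv ?_
    simp only [g, f]
    linear_combination (Real.exp (ρ t) * Real.cos (β t) * q t) * Real.sin_sq_add_cos_sq (β t)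

theorem aux_wronsk (q : ℝ → ℝ) (a : ℝ) (ha : 0 < a) (u v : ℝ → ℝ) (w z : ℝ → ℂ)
    (hu : ∀ t ∈ Set.Ioo (-(a+1)) (a+1), HasDerivAt u (v t) t ∧ HasDerivAt v (q t * u t) t)
    (hw : ∀ t ∈ Set.Ioo (-(a+1)) (a+1), HasDerivAt w (z t) t ∧ HasDerivAt z (q t * w t) t) :
    w a * v a - z a * u a = w (-a) * v (-a) - z (-a) * u (-a) := by
  have hd : ∀ t ∈ Set.Ioo (-(a+1)) (a+1),
      HasDerivAt (fun t => w t * (v t : ℂ) - z t * (u t : ℂ)) 0 t := by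
    intro t ht
    have h := ((hw t ht).1.mul (hu t ht).2.ofReal_comp).sub
      ((hw t ht).2.mul (hu t ht).1.ofReal_comp)
    refine h.congr_deriv ?_
    push_cast
    ring
  refine isOpen_Ioo.is_const_of_deriv_eq_zero (isPreconnected_Ioo (a := -(a+1)) (b := a+1))
    (f := fun t => w t * (v t : ℂ) - z t * (u t : ℂ))
    (fun t ht => (hd t ht).differentiableAt.differentiableWithinAt)
    (fun t ht => (hd t ht).deriv) ⟨by linarith, by linarith⟩ ⟨by linarith, by linarith⟩

/-- Real transfer matrix. -/
theorem aux_transfer (q : ℝ → ℝ) (hq : Continuous q) (a : ℝ) (ha : 0 < a) :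
    ∃ n₁ n₂ n₃ n₄ : ℝ, n₁ * n₄ - n₂ * n₃ = 1 ∧
      ∀ w z : ℝ → ℂ, (∀ t, HasDerivAt w (z t) t ∧ HasDerivAt z (q t * w t) t) →
        w a = n₁ * w (-a) + n₂ * z (-a) ∧ z a = n₃ * w (-a) + n₄ * z (-a) := by
  obtain ⟨u₁, v₁, hu10, hv10, h1⟩ := aux_prufer q hq a ha 0
  obtain ⟨u₂, v₂, hu20, hv20, h2⟩ := aux_prufer q hq a ha (Real.pi / 2)
  simp only [Real.cos_zero, Real.sin_zero, Real.cos_pi_div_two, Real.sin_pi_div_two] at *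
  have hW : u₁ a * v₂ a - u₂ a * v₁ a = 1 := by
    have := aux_wronsk q a ha u₂ v₂ (fun t => u₁ t) (fun t => v₁ t) h2
      (fun t ht => ⟨(h1 t ht).1.ofReal_comp, by
        simpa using (h1 t ht).2.ofReal_comp⟩)
    rw [hu10, hv10, hu20, hv20] at this
    have h3 : ((u₁ a * v₂ a - v₁ a * u₂ a : ℝ) : ℂ) = (1 : ℝ) := by
      push_cast; rw [this]; simp
    have := Complex.ofReal_injective h3
    linarith
  refine ⟨u₁ a, u₂ a, v₁ a, v₂ a, hW, fun w z hwz => ?_⟩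
  have e1 := aux_wronsk q a ha u₁ v₁ w z h1 (fun t _ => hwz t)
  have e2 := aux_wronsk q a ha u₂ v₂ w z h2 (fun t _ => hwz t)
  rw [hu10, hv10] at e1
  rw [hu20, hv20] at e2
  have hW' : (u₁ a : ℂ) * v₂ a - u₂ a * v₁ a = 1 := by exact_mod_cast hW
  push_cast at e1 e2
  constructor
  · linear_combination (-(w a)) * hW' + (u₁ a : ℂ) * e2 - (u₂ a : ℂ) * e1
  · linear_combination (-(z a)) * hW' + (v₁ a : ℂ) * e2 - (v₂ a : ℂ) * e1

theorem aux_exp (k : ℝ) (x : ℝ) :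
    HasDerivAt (fun x : ℝ => Complex.exp (I * k * x)) (Complex.exp (I * k * x) * (I * k)) x := by
  have h : HasDerivAt (fun x : ℝ => I * k * (x : ℂ)) (I * k * 1) x :=
    (Complex.ofRealCLM.hasDerivAt (x := x)).const_mul (I * (k : ℂ))
  simpa using h.cexp

theorem aux_exp' (k : ℝ) (x : ℝ) :
    HasDerivAt (fun x : ℝ => Complex.exp (-(I * k * x)))
      (Complex.exp (-(I * k * x)) * (-(I * k))) x := by
  have h : HasDerivAt (fun x : ℝ => -(I * k * (x : ℂ))) (-(I * k * 1)) x :=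
    ((Complex.ofRealCLM.hasDerivAt (x := x)).const_mul (I * (k : ℂ))).neg
  simpa using h.cexp

theorem aux_closure (k : ℝ) (s : Set ℝ) (hs : IsOpen s) (ψ : ℝ → ℂ) (P Q : ℂ)
    (h1 : Differentiable ℝ ψ) (h2 : Differentiable ℝ (deriv ψ))
    (h : ∀ x ∈ s, ψ x = P * Complex.exp (I * k * x) + Q * Complex.exp (-(I * k * x)))
    (x : ℝ) (hx : x ∈ closure s) :
    ψ x = P * Complex.exp (I * k * x) + Q * Complex.exp (-(I * k * x)) ∧
    deriv ψ x = I * k * (P * Complex.exp (I * k * x) - Q * Complex.exp (-(I * k * x))) := by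
  constructor
  · have : Set.EqOn ψ (fun x : ℝ => P * Complex.exp (I * k * x) + Q * Complex.exp (-(I * k * x))) s := h
    exact this.closure h1.continuous (by fun_prop) hx
  · have : Set.EqOn (deriv ψ) (fun x : ℝ =>
        I * k * (P * Complex.exp (I * k * x) - Q * Complex.exp (-(I * k * x)))) s := by
      intro y hy
      have hd := ((aux_exp k y).const_mul P).add ((aux_exp' k y).const_mul Q)
      have he : ψ =ᶠ[nhds y] ((fun x : ℝ => P * Complex.exp (I * k * x)) +
          fun x : ℝ => Q * Complex.exp (-(I * k * x))) := by
        filter_upwards [hs.mem_nhds hy] with t ht using h t ht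
      rw [he.deriv_eq, hd.deriv]
      ring
    exact this.closure h2.continuous (by fun_prop) hx

/-- Free solutions on the right are plane waves. -/
theorem aux_free (k : ℝ) (hk : 0 < k) (a : ℝ) (w z : ℝ → ℂ)
    (h : ∀ t, a ≤ t → HasDerivAt w (z t) t ∧ HasDerivAt z (-(k : ℂ) ^ 2 * w t) t) :
    ∃ P Q : ℂ, ∀ x : ℝ, a ≤ x →
      w x = P * Complex.exp (I * k * x) + Q * Complex.exp (-(I * k * x)) := by
  have hk' : (k : ℂ) ≠ 0 := by exact_mod_cast hk.ne'
  have hd1 : ∀ t, a ≤ t → HasDerivAt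
      (fun t : ℝ => (z t + I * k * w t) * Complex.exp (-(I * k * t))) 0 t := by
    intro t ht
    refine (((h t ht).2.add ((h t ht).1.const_mul (I * k))).mul (aux_exp' k t)).congr_deriv ?_
    simp only [Pi.add_apply]
    linear_combination (-(k : ℂ) ^ 2 * w t * Complex.exp (-(I * k * t))) * I_sq
  have hd2 : ∀ t, a ≤ t → HasDerivAt
      (fun t : ℝ => (z t - I * k * w t) * Complex.exp (I * k * t)) 0 t := by
    intro t ht
    refine (((h t ht).2.sub ((h t ht).1.const_mul (I * k))).mul (aux_exp k t)).congr_deriv ?_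
    simp only [Pi.sub_apply]
    linear_combination (-(k : ℂ) ^ 2 * w t * Complex.exp (I * k * t)) * I_sq
  refine ⟨(z a + I * k * w a) * Complex.exp (-(I * k * a)) / (2 * I * k),
    -((z a - I * k * w a) * Complex.exp (I * k * a)) / (2 * I * k), fun x hx => ?_⟩
  have c1 := constant_of_has_deriv_right_zero (a := a) (b := x)
    (fun t ht => (hd1 t ht.1).continuousAt.continuousWithinAt)
    (fun t ht => (hd1 t ht.1).hasDerivWithinAt) x ⟨hx, le_rfl⟩
  have c2 := constant_of_has_deriv_right_zero (a := a) (b := x)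
    (fun t ht => (hd2 t ht.1).continuousAt.continuousWithinAt)
    (fun t ht => (hd2 t ht.1).hasDerivWithinAt) x ⟨hx, le_rfl⟩
  have he : Complex.exp (I * k * x) * Complex.exp (-(I * k * x)) = 1 := by
    rw [← Complex.exp_add]; simp
  rw [← c1, ← c2]
  have hI := I_ne_zero
  field_simp
  linear_combination (-2 * I * k * w x) * he

theorem aux_SU (k : ℂ) (hk : k ≠ 0) (hkc : star k = k) (e f p q r s : ℂ) (hef : e * f = 1)
    (hec : star e = f) (hp : star p = p) (hq : star q = q) (hr : star r = r) (hs : star s = s)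
    (hd : p * s - q * r = 1) :
    SU11 !![f * ((r * f + s * (I * k) * f) + I * k * (p * f + q * (I * k) * f)) / (2 * I * k),
      f * ((r * e - s * (I * k) * e) + I * k * (p * e - q * (I * k) * e)) / (2 * I * k);
      -e * ((r * f + s * (I * k) * f) - I * k * (p * f + q * (I * k) * f)) / (2 * I * k),
      -e * ((r * e - s * (I * k) * e) - I * k * (p * e - q * (I * k) * e)) / (2 * I * k)] := by
  have hfc : star f = e := by rw [← hec, star_star]
  have hIc : star I = -I := by simp
  have key : ∀ α β γ δ : ℂ, star α = δ → star β = γ → α * δ - β * γ = 1 →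
      SU11 !![α, β; γ, δ] := by
    intro α β γ δ h1 h2 h3
    have h1' : star δ = α := by rw [← h1, star_star]
    have h2' : star γ = β := by rw [← h2, star_star]
    refine ⟨by rw [Matrix.det_fin_two_of, h3], ?_⟩
    rw [← starRingEnd_apply] at h1 h2 h1' h2'
    ext i j
    fin_cases i <;> fin_cases j <;>
      simp [etaMat, Matrix.mul_apply, Fin.sum_univ_two, Matrix.diagonal,
        h1, h2, h1', h2'] <;>
      first
        | ring1
        | linear_combination h3
        | linear_combination -h3
  apply key
  · simp only [star_div₀, star_mul', star_add, star_sub, star_neg, hfc, hec, hIc, hkc, hp, hq, hr, hs]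
    have hI := I_ne_zero
    simp only [star_ofNat]
    field_simp
    ring
  · simp only [star_div₀, star_mul', star_add, star_sub, star_neg, hfc, hec, hIc, hkc, hp, hq, hr, hs]
    have hI := I_ne_zero
    simp only [star_ofNat]
    field_simp
    ring
  · have hw : I * k ≠ 0 := mul_ne_zero I_ne_zero hk
    have h2 : (2 : ℂ) * I * k = 2 * (I * k) := by ring
    rw [h2]
    generalize I * k = w at hw
    have h3 : ∀ x y z t : ℂ, x / (2 * w) * (y / (2 * w)) - z / (2 * w) * (t / (2 * w)) =
        (x * y - z * t) / (4 * w ^ 2) := by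
      intro x y z t
      field_simp
      ring
    rw [h3, div_eq_one_iff_eq (mul_ne_zero (by norm_num) (pow_ne_zero 2 hw))]
    linear_combination (4 * w ^ 2) * hd + (4 * w ^ 2 * (p * s - q * r) * (e * f + 1)) * hef

theorem stmt16 (V : ℝ → ℝ) (hVc : Continuous V) (a : ℝ) (ha : 0 < a)
    (hsupp : Function.support V ⊆ Set.Icc (-a) a) (k : ℝ) (hk : 0 < k) :
    ∃ M : Matrix (Fin 2) (Fin 2) ℂ, SU11 M ∧
      ∀ (A' A : ℂ) (ψ : ℝ → ℂ),
        Differentiable ℝ ψ → Differentiable ℝ (deriv ψ) →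
        (∀ x : ℝ, -(deriv (deriv ψ) x) + (V x : ℂ) * ψ x = ((k : ℂ) ^ 2) * ψ x) →
        (∀ x : ℝ, x < -a →
          ψ x = A' * Complex.exp (Complex.I * k * x) +
                A * Complex.exp (-(Complex.I * k * x))) →
        (∃! p : ℂ × ℂ, ∀ x : ℝ, a < x →
          ψ x = p.1 * Complex.exp (Complex.I * k * x) +
                p.2 * Complex.exp (-(Complex.I * k * x))) ∧
        (∀ B B' : ℂ,
          (∀ x : ℝ, a < x →
            ψ x = B * Complex.exp (Complex.I * k * x) +
                  B' * Complex.exp (-(Complex.I * k * x))) →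
          B = M 0 0 * A' + M 0 1 * A ∧ B' = M 1 0 * A' + M 1 1 * A) := by
  have hVr : ∀ x, a ≤ x → V x = 0 := by
    have h0 : Set.EqOn V (fun _ => 0) (Set.Ioi a) := by
      intro x hx
      by_contra h
      exact absurd (hsupp h).2 (not_le.2 hx)
    intro x hx
    exact h0.closure hVc continuous_const (by rw [closure_Ioi]; exact hx)
  obtain ⟨n₁, n₂, n₃, n₄, hdet, hN⟩ := aux_transfer (fun x => V x - k ^ 2)
    (by fun_prop) a ha
  have hk' : (k : ℂ) ≠ 0 := by exact_mod_cast hk.ne'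
  have hI := I_ne_zero
  have hef : Complex.exp (I * k * a) * Complex.exp (-(I * k * a)) = 1 := by
    rw [← Complex.exp_add]; simp
  have hSU := aux_SU k hk' (by simp) (Complex.exp (I * k * a)) (Complex.exp (-(I * k * a)))
    n₁ n₂ n₃ n₄ hef (by simp [← Complex.exp_conj]) (by simp) (by simp) (by simp) (by simp)
    (by exact_mod_cast hdet)
  refine ⟨_, hSU, ?_⟩
  intro A' A ψ h1 h2 hode hleft
  have hsys : ∀ t, HasDerivAt ψ (deriv ψ t) t ∧
      HasDerivAt (deriv ψ) (((V t - k ^ 2 : ℝ) : ℂ) * ψ t) t := by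
    intro t
    refine ⟨(h1 t).hasDerivAt, (h2 t).hasDerivAt.congr_deriv ?_⟩
    push_cast
    linear_combination -(hode t)
  obtain ⟨t1, t2⟩ := hN ψ (deriv ψ) hsys
  obtain ⟨l1, l2⟩ := aux_closure k (Set.Iio (-a)) isOpen_Iio ψ A' A h1 h2 hleft (-a)
    (by rw [closure_Iio]; exact Set.mem_Iic.2 le_rfl)
  have hn : I * (k : ℂ) * ((-a : ℝ) : ℂ) = -(I * k * a) := by push_cast; ring
  rw [hn, neg_neg] at l1 l2
  rw [l1, l2] at t1 t2
  have hB : ∀ B B' : ℂ,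
          (∀ x : ℝ, a < x →
            ψ x = B * Complex.exp (Complex.I * k * x) +
                  B' * Complex.exp (-(Complex.I * k * x))) →
      B = Complex.exp (-(I * k * a)) * (deriv ψ a + I * k * ψ a) / (2 * I * k) ∧
      B' = -Complex.exp (I * k * a) * (deriv ψ a - I * k * ψ a) / (2 * I * k) := by
    intro B B' hBB
    obtain ⟨r1, r2⟩ := aux_closure k (Set.Ioi a) isOpen_Ioi ψ B B' h1 h2 hBB a
      (by rw [closure_Ioi]; exact Set.mem_Ici.2 le_rfl)
    rw [r1, r2]
    constructor
    · field_simp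
      linear_combination (-2 * B) * hef
    · field_simp
      linear_combination (-2 * B') * hef
  refine ⟨?_, ?_⟩
  · obtain ⟨P, Q, hPQ⟩ := aux_free k hk a ψ (deriv ψ) (fun t ht => ⟨(hsys t).1,
      (hsys t).2.congr_deriv (by rw [hVr t ht]; push_cast; ring)⟩)
    have hPQ' := hB P Q (fun x hx => hPQ x hx.le)
    refine ⟨(P, Q), fun x hx => hPQ x hx.le, ?_⟩
    rintro ⟨B, B'⟩ hBB
    have := hB B B' hBB
    rw [Prod.mk.injEq, this.1, this.2, hPQ'.1, hPQ'.2]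
    exact ⟨rfl, rfl⟩
  · intro B B' hBB
    obtain ⟨b1, b2⟩ := hB B B' hBB
    rw [b1, b2, t1, t2]
    simp only [Matrix.of_apply, Matrix.cons_val', Matrix.cons_val_zero, Matrix.cons_val_one,
      Matrix.cons_val_fin_one]
    constructor <;> ring
end
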